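/- The set of purely imaginary roots of the characteristic equation, {λ ∈ ℂ : Re(λ) = 0 and h_ϑ(λ) = 0}, is finite. -/

import Mathlib

open MeasureTheory

/-- Integral of a complex-valued function on `[−r, 0]` with respect to a finite signed
measure `a`, computed via the Jordan decomposition `a = a⁺ − a⁻`. -/
noncomputable def signedIntegral (a : SignedMeasure ℝ) (r : ℝ) (f : ℝ → ℂ) : ℂ :=
  (∫ u in Set.Icc (-r) 0, f u ∂a.toJordanDecomposition.posPart) -
    ∫ u in Set.Icc (-r) 0, f u ∂a.toJordanDecomposition.negPart

/-- The characteristic function `h_ϑ(λ) = λ − ϑ ∫_{[−r,0]} e^{λu} a(du)`. -/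
noncomputable def charFn (a : SignedMeasure ℝ) (r ϑ : ℝ) (lam : ℂ) : ℂ :=
  lam - ϑ * signedIntegral a r (fun u => Complex.exp (lam * u))

theorem ProbabilityTheory.integrableExpSet_id_restrict_Icc (μ : Measure ℝ) [IsFiniteMeasure μ]
    (s t : ℝ) : ProbabilityTheory.integrableExpSet id (μ.restrict (Set.Icc s t)) = Set.univ := by
  refine Set.eq_univ_of_forall fun x => ?_
  have hc : Continuous fun u : ℝ => Real.exp (x * id u) := by fun_prop
  exact hc.continuousOn.integrableOn_compact isCompact_Icc

theorem ProbabilityTheory.differentiable_complexMGF_id_restrict_Icc (μ : Measure ℝ)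
    [IsFiniteMeasure μ] (s t : ℝ) :
    Differentiable ℂ (ProbabilityTheory.complexMGF id (μ.restrict (Set.Icc s t))) := fun z =>
  (ProbabilityTheory.analyticAt_complexMGF
    (by simp [ProbabilityTheory.integrableExpSet_id_restrict_Icc])).differentiableAt

theorem ProbabilityTheory.norm_complexMGF_le_of_re_eq_zero {Ω : Type*} [MeasurableSpace Ω]
    (X : Ω → ℝ) (μ : Measure Ω) {z : ℂ} (hz : z.re = 0) :
    ‖ProbabilityTheory.complexMGF X μ z‖ ≤ μ.real Set.univ := by
  have h := ProbabilityTheory.norm_complexMGF_le_mgf (X := X) (μ := μ) (z := z)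
  rwa [hz, ProbabilityTheory.mgf_zero'] at h

theorem charFn_eq_complexMGF (a : SignedMeasure ℝ) (r ϑ : ℝ) (lam : ℂ) :
    charFn a r ϑ lam = lam - ϑ *
      (ProbabilityTheory.complexMGF id
          (a.toJordanDecomposition.posPart.restrict (Set.Icc (-r) 0)) lam -
        ProbabilityTheory.complexMGF id
          (a.toJordanDecomposition.negPart.restrict (Set.Icc (-r) 0)) lam) :=
  rfl

theorem differentiable_charFn (a : SignedMeasure ℝ) (r ϑ : ℝ) :
    Differentiable ℂ (charFn a r ϑ) := by
  rw [funext (charFn_eq_complexMGF a r ϑ)]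
  exact differentiable_id.sub
    (((ProbabilityTheory.differentiable_complexMGF_id_restrict_Icc _ _ _).sub
      (ProbabilityTheory.differentiable_complexMGF_id_restrict_Icc _ _ _)).const_mul _)

/-- The purely imaginary roots of the characteristic function are uniformly bounded. -/
theorem exists_norm_le_of_charFn_eq_zero (a : SignedMeasure ℝ) (r ϑ : ℝ) :
    ∃ C : ℝ, 0 ≤ C ∧ ∀ lam : ℂ, lam.re = 0 → charFn a r ϑ lam = 0 → ‖lam‖ ≤ C := by
  refine ⟨|ϑ| * ((a.toJordanDecomposition.posPart.restrict (Set.Icc (-r) 0)).real Set.univ +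
    (a.toJordanDecomposition.negPart.restrict (Set.Icc (-r) 0)).real Set.univ), by positivity,
    fun lam hre h0 => ?_⟩
  rw [charFn_eq_complexMGF, sub_eq_zero] at h0
  rw [h0, norm_mul, Complex.norm_real, Real.norm_eq_abs]
  gcongr
  exact (norm_sub_le _ _).trans (add_le_add
    (ProbabilityTheory.norm_complexMGF_le_of_re_eq_zero _ _ hre)
    (ProbabilityTheory.norm_complexMGF_le_of_re_eq_zero _ _ hre))

/-- The set of purely imaginary roots of the characteristic equation is finite. -/
theorem finite_imaginary_roots (r : ℝ) (hr : 0 < r) (a : SignedMeasure ℝ) (ϑ : ℝ) :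
    {lam : ℂ | lam.re = 0 ∧ charFn a r ϑ lam = 0}.Finite := by
  obtain ⟨C, hC0, hC⟩ := exists_norm_le_of_charFn_eq_zero a r ϑ
  have hne : charFn a r ϑ ((C + 1 : ℝ) * Complex.I) ≠ 0 := fun h => by
    have := hC _ (by simp) h
    rw [norm_mul, Complex.norm_real, Complex.norm_I, mul_one, Real.norm_eq_abs,
      abs_of_nonneg (by linarith)] at this
    linarith
  have han : AnalyticOnNhd ℂ (charFn a r ϑ) Set.univ := fun z _ =>
    (differentiable_charFn a r ϑ).analyticAt z
  have hfin := (isCompact_closedBall (0 : ℂ) C).finite_sdiff_of_mem_codiscreteWithin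
    (Filter.codiscreteWithin_mono (Set.subset_univ _) (han.preimage_zero_mem_codiscrete hne))
  refine hfin.subset fun lam h => ⟨?_, ?_⟩
  · simpa using hC lam h.1 h.2
  · simpa using h.2
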